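/- arXiv:2008.09555 — 4 statements merged into one kernel-verified Lean document; each statement's English description precedes it below -/
import Mathlib

section
/- Let N ≥ 1 be an integer. Suppose p : {0,…,N} → ℝ satisfies p_j ≥ 0 for all j and Σ_{j=0}^{N} p_j = 1, and μ : {0,…,N−1} → ℝ satisfies 0 ≤ μ_J, μ_J ≤ p_J, and μ_J ≤ p_{J+1} for all J ∈ {0,…,N−1}. Then Σ_{J=0}^{N−1} μ_J ≤ N/(N+1). -/
/-- The linear-programming upper bound for `N → 1` probabilistic storage and
retrieval of qubit phase gates: if `p : {0,…,N} → ℝ` is a probability vector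
and `0 ≤ μ_J ≤ p_J`, `μ_J ≤ p_{J+1}` for every `J ∈ {0,…,N-1}`, then
`∑_J μ_J ≤ N/(N+1)`. -/
theorem stmt0 (N : ℕ) (hN : 1 ≤ N)
    (p : Fin (N + 1) → ℝ) (μ : Fin N → ℝ)
    (hp : ∀ j, 0 ≤ p j) (hpsum : ∑ j, p j = 1)
    (hμ0 : ∀ J, 0 ≤ μ J)
    (hμ1 : ∀ J, μ J ≤ p J.castSucc)
    (hμ2 : ∀ J, μ J ≤ p J.succ) :
    ∑ J, μ J ≤ (N : ℝ) / (N + 1) := by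
  have hleft : ∑ j : Fin (N + 1), ((N : ℝ) - (j : ℕ)) * p j
      = ∑ J : Fin N, ((N : ℝ) - (J : ℕ)) * p J.castSucc := by
    simp [Fin.sum_univ_castSucc]
  have hright : ∑ j : Fin (N + 1), ((j : ℕ) : ℝ) * p j
      = ∑ J : Fin N, (((J : ℕ) : ℝ) + 1) * p J.succ := by
    simp [Fin.sum_univ_succ]
  rw [le_div_iff₀ (by positivity)]
  calc (∑ J, μ J) * ((N : ℝ) + 1)
      = ∑ J : Fin N, (((N : ℝ) - (J : ℕ)) * μ J + (((J : ℕ) : ℝ) + 1) * μ J) := by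
        rw [Finset.sum_mul]
        exact Finset.sum_congr rfl fun J _ => by ring
    _ ≤ ∑ J : Fin N, (((N : ℝ) - (J : ℕ)) * p J.castSucc
          + (((J : ℕ) : ℝ) + 1) * p J.succ) := by
        refine Finset.sum_le_sum fun J _ => add_le_add ?_ ?_
        · have hJ : ((J : ℕ) : ℝ) ≤ N := by exact_mod_cast J.isLt.le
          exact mul_le_mul_of_nonneg_left (hμ1 J) (sub_nonneg.mpr hJ)
        · exact mul_le_mul_of_nonneg_left (hμ2 J) (by positivity)
    _ = ∑ j : Fin (N + 1), (N : ℝ) * p j := by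
        rw [Finset.sum_add_distrib, ← hleft, ← hright, ← Finset.sum_add_distrib]
        exact Finset.sum_congr rfl fun j _ => by ring
    _ = N := by rw [← Finset.mul_sum, hpsum, mul_one]
end

section
/- Let N ≥ 1 be an integer. The maximum of Σ_{J=0}^{N−1} μ_J over all p : {0,…,N} → ℝ with p_j ≥ 0 and Σ_j p_j = 1 and all μ : {0,…,N−1} → ℝ with 0 ≤ μ_J ≤ p_J and μ_J ≤ p_{J+1} for every J, equals N/(N+1); it is attained by p_j = 1/(N+1) for all j and μ_J = 1/(N+1) for all J. -/
/-- Linear programming duality bound: a vector dominated by both shifts of `p` has sum at most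
`N / (N + 1)` times that of `p`. The dual weights are `N - J` for `p_J` and `J + 1` for `p_{J+1}`. -/
theorem succ_mul_sum_le_mul_sum (N : ℕ) (p : Fin (N + 1) → ℝ) (μ : Fin N → ℝ)
    (h₁ : ∀ J, μ J ≤ p J.castSucc) (h₂ : ∀ J, μ J ≤ p J.succ) :
    ((N : ℝ) + 1) * ∑ J, μ J ≤ N * ∑ j, p j := by
  have hleft : ∑ j : Fin (N + 1), ((N : ℝ) - (j : ℕ)) * p j =
      ∑ J : Fin N, ((N : ℝ) - (J : ℕ)) * p J.castSucc := by
    simp [Fin.sum_univ_castSucc]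
  have hright : ∑ j : Fin (N + 1), ((j : ℕ) : ℝ) * p j =
      ∑ J : Fin N, (((J : ℕ) : ℝ) + 1) * p J.succ := by
    simp [Fin.sum_univ_succ]
  calc ((N : ℝ) + 1) * ∑ J, μ J
      = ∑ J : Fin N, (((N : ℝ) - (J : ℕ)) * μ J + (((J : ℕ) : ℝ) + 1) * μ J) := by
        rw [Finset.mul_sum]
        exact Finset.sum_congr rfl fun J _ => by ring
    _ ≤ ∑ J : Fin N,
          (((N : ℝ) - (J : ℕ)) * p J.castSucc + (((J : ℕ) : ℝ) + 1) * p J.succ) := by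
        refine Finset.sum_le_sum fun J _ => add_le_add ?_ ?_
        · have hJ : ((J : ℕ) : ℝ) ≤ N := by exact_mod_cast J.isLt.le
          exact mul_le_mul_of_nonneg_left (h₁ J) (sub_nonneg.2 hJ)
        · exact mul_le_mul_of_nonneg_left (h₂ J) (by positivity)
    _ = N * ∑ j, p j := by
        rw [Finset.sum_add_distrib, ← hleft, ← hright, ← Finset.sum_add_distrib, Finset.mul_sum]
        exact Finset.sum_congr rfl fun j _ => by ring

/-- The exact value of the linear program governing `N → 1` probabilistic
storage and retrieval of qubit phase gates: the maximum of `∑_J μ_J` subject to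
`p` being a probability vector on `{0,…,N}` and `0 ≤ μ_J ≤ p_J`, `μ_J ≤ p_{J+1}`
equals `N/(N+1)`, and it is attained by `p_j = 1/(N+1)`, `μ_J = 1/(N+1)`. -/
theorem stmt1 (N : ℕ) (hN : 1 ≤ N) :
    IsGreatest {lam : ℝ | ∃ (p : Fin (N + 1) → ℝ) (μ : Fin N → ℝ),
        (∀ j, 0 ≤ p j) ∧ (∑ j, p j = 1) ∧
        (∀ J, 0 ≤ μ J) ∧ (∀ J, μ J ≤ p J.castSucc) ∧ (∀ J, μ J ≤ p J.succ) ∧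
        lam = ∑ J, μ J}
      ((N : ℝ) / (N + 1)) ∧
    (let p : Fin (N + 1) → ℝ := fun _ => 1 / (N + 1)
     let μ : Fin N → ℝ := fun _ => 1 / (N + 1)
     (∀ j, 0 ≤ p j) ∧ (∑ j, p j = 1) ∧
     (∀ J, 0 ≤ μ J) ∧ (∀ J, μ J ≤ p J.castSucc) ∧ (∀ J, μ J ≤ p J.succ) ∧
     (∑ J, μ J = (N : ℝ) / (N + 1))) := by
  have hpos : (0 : ℝ) < N + 1 := by positivity
  have hnonneg : (0 : ℝ) ≤ 1 / (N + 1) := by positivity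
  have hp : ∑ _j : Fin (N + 1), (1 : ℝ) / (N + 1) = 1 := by
    simp [hpos.ne']
  have hμ : ∑ _J : Fin N, (1 : ℝ) / (N + 1) = N / (N + 1) := by
    simp [div_eq_mul_inv]
  refine ⟨⟨⟨fun _ => 1 / (N + 1), fun _ => 1 / (N + 1), fun _ => hnonneg, hp, fun _ => hnonneg,
    fun _ => le_rfl, fun _ => le_rfl, hμ.symm⟩, ?_⟩, fun _ => hnonneg, hp, fun _ => hnonneg,
    fun _ => le_rfl, fun _ => le_rfl, hμ⟩
  rintro _ ⟨p, μ, -, hsum, -, h₁, h₂, rfl⟩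
  rw [le_div_iff₀ hpos, mul_comm]
  simpa [hsum] using succ_mul_sum_le_mul_sum N p μ h₁ h₂
end

section
/- Let N ≥ 0 and let p_0, …, p_N be strictly positive reals. Then the set of vectors { Σ_{j=0}^{N} √(p_j) e^{ijφ} e_j : φ ∈ ℝ } spans ℂ^{N+1}, where (e_j) is the standard basis of ℂ^{N+1}. -/
noncomputable section

/-- A complex polynomial vanishing on the unit circle is zero. -/
theorem Polynomial.eq_zero_of_forall_eval_exp_eq_zero (P : Polynomial ℂ)
    (hP : ∀ φ : ℝ, P.eval (Complex.exp (φ * Complex.I)) = 0) : P = 0 := by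
  apply Polynomial.eq_zero_of_infinite_isRoot
  have hinj : Set.InjOn (fun φ : ℝ => Complex.exp (φ * Complex.I))
      (Set.Ioc (-Real.pi) Real.pi) := by
    intro a ha b hb hab
    have h := congrArg Complex.arg hab
    simpa only [Complex.arg_exp_mul_I, (toIocMod_eq_self Real.two_pi_pos).2
      (show a ∈ Set.Ioc (-Real.pi) (-Real.pi + 2 * Real.pi) from ⟨ha.1, by linarith [ha.2]⟩),
      (toIocMod_eq_self Real.two_pi_pos).2
      (show b ∈ Set.Ioc (-Real.pi) (-Real.pi + 2 * Real.pi) from ⟨hb.1, by linarith [hb.2]⟩)]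
      using h
  refine ((Set.Ioc_infinite (by linarith [Real.pi_pos])).image hinj).mono ?_
  rintro _ ⟨φ, -, rfl⟩
  exact hP φ

/-- The family of possible storage states `ψ_φ = Σ_j √(p_j) e^{ijφ} e_j`, `φ ∈ ℝ`,
spans `ℂ^{N+1}` whenever all the amplitudes `p_j` are strictly positive. -/
theorem stmt10 (N : ℕ) (p : Fin (N + 1) → ℝ) (hp : ∀ j, 0 < p j) :
    Submodule.span ℂ
      {v : EuclideanSpace ℂ (Fin (N + 1)) | ∃ φ : ℝ,
        v = ∑ j : Fin (N + 1),
          ((Real.sqrt (p j) : ℂ) * Complex.exp (Complex.I * (j : ℕ) * φ)) •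
            EuclideanSpace.single j (1 : ℂ)} = ⊤ := by
  by_contra hne
  obtain ⟨f, hf0, hf⟩ := Submodule.exists_le_ker_of_lt_top _ (lt_top_iff_ne_top.2 hne)
  set P : Polynomial ℂ := ∑ j : Fin (N + 1), Polynomial.monomial (j : ℕ)
    ((Real.sqrt (p j) : ℂ) * f (EuclideanSpace.single j (1 : ℂ))) with hPdef
  have hP : P = 0 := by
    apply Polynomial.eq_zero_of_forall_eval_exp_eq_zero
    intro φ
    have h := LinearMap.mem_ker.1 (hf (Submodule.subset_span ⟨φ, rfl⟩))
    simp only [map_sum, map_smul, smul_eq_mul] at h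
    rw [hPdef, Polynomial.eval_finsetSum, ← h]
    refine Finset.sum_congr rfl fun j _ => ?_
    rw [Polynomial.eval_monomial, ← Complex.exp_nat_mul,
      show ((j : ℕ) : ℂ) * (φ * Complex.I) = Complex.I * (j : ℕ) * φ by ring]
    ring
  apply hf0
  apply (EuclideanSpace.basisFun (Fin (N + 1)) ℂ).toBasis.ext
  intro j
  have hc : P.coeff j = 0 := by rw [hP, Polynomial.coeff_zero]
  simp only [hPdef, Polynomial.finsetSum_coeff, Polynomial.coeff_monomial, Fin.val_inj,
    Finset.sum_ite_eq', Finset.mem_univ, if_true] at hc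
  have hs : (Real.sqrt (p j) : ℂ) ≠ 0 := Complex.ofReal_ne_zero.2 (Real.sqrt_pos.2 (hp j)).ne'
  simpa using (mul_eq_zero.1 hc).resolve_left hs
end
end

section
/- Let N ≥ 1. For nonnegative reals μ_{−1}, μ_0, …, μ_N with μ_{−1} = μ_N = 0, nonnegative reals p_0, …, p_N with Σ_{J=0}^{N} p_J = 1 satisfying μ_J ≤ p_J and μ_{J−1} ≤ p_J for all J ∈ {0,…,N}, and coefficients f_J = (N − J)/N for J = 0,…,N, one has Σ_{J=0}^{N} ( f_J μ_J + (1 − f_J) μ_{J−1} ) ≤ 1, and the left-hand side equals ((N+1)/N) Σ_{J=0}^{N−1} μ_J. -/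
theorem sum_Icc_zero_succ (g : ℤ → ℝ) (n : ℕ) :
    ∑ J ∈ Finset.Icc (0 : ℤ) ((n + 1 : ℕ) : ℤ), g J
      = ∑ J ∈ Finset.Icc (0 : ℤ) (n : ℤ), g J + g ((n : ℤ) + 1) := by
  have h : Finset.Icc (0 : ℤ) ((n + 1 : ℕ) : ℤ)
      = insert ((n : ℤ) + 1) (Finset.Icc (0 : ℤ) (n : ℤ)) := by
    ext x
    simp only [Finset.mem_Icc, Finset.mem_insert]
    omega
  rw [h, Finset.sum_insert (by simp), add_comm]

/-- Shifting the index in the second summand collects all weights of `μ J` with `J < n` into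
`(c + 1) / c`, leaving a boundary term at `n`. -/
theorem sum_Icc_weighted_shift (c : ℝ) (hc : c ≠ 0) (μ : ℤ → ℝ) (n : ℕ) :
    ∑ J ∈ Finset.Icc (0 : ℤ) (n : ℤ), ((c - J) / c * μ J + (1 - (c - J) / c) * μ (J - 1))
      = (c + 1) / c * ∑ J ∈ Finset.Icc (0 : ℤ) ((n : ℤ) - 1), μ J + (c - n) / c * μ n := by
  induction n with
  | zero => simp [hc]
  | succ n ih =>
    have hs : ∑ J ∈ Finset.Icc (0 : ℤ) (n : ℤ), μ J
        = ∑ J ∈ Finset.Icc (0 : ℤ) ((n : ℤ) - 1), μ J + μ n := by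
      cases n with
      | zero => simp
      | succ m => simpa using sum_Icc_zero_succ μ m
    rw [sum_Icc_zero_succ, ih]
    push_cast
    simp only [add_sub_cancel_right]
    rw [hs]
    field_simp
    ring


/-- The weighted-sum inequality (Eq. 27 of the paper): with `μ_{−1} = μ_N = 0`,
`0 ≤ μ_J`, `p` a probability vector on `{0,…,N}`, `μ_J ≤ p_J`, `μ_{J−1} ≤ p_J`
and `f_J = (N−J)/N`, one has `∑_{J=0}^{N} (f_J μ_J + (1−f_J) μ_{J−1}) ≤ 1`,
and this sum equals `((N+1)/N) ∑_{J=0}^{N−1} μ_J`. -/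
theorem stmt16 (N : ℕ) (hN : 1 ≤ N)
    (μ p : ℤ → ℝ)
    (hμ0 : ∀ J ∈ Finset.Icc (-1 : ℤ) (N : ℤ), 0 ≤ μ J)
    (hμm1 : μ (-1) = 0) (hμN : μ (N : ℤ) = 0)
    (hp0 : ∀ J ∈ Finset.Icc (0 : ℤ) (N : ℤ), 0 ≤ p J)
    (hpsum : ∑ J ∈ Finset.Icc (0 : ℤ) (N : ℤ), p J = 1)
    (h1 : ∀ J ∈ Finset.Icc (0 : ℤ) (N : ℤ), μ J ≤ p J)
    (h2 : ∀ J ∈ Finset.Icc (0 : ℤ) (N : ℤ), μ (J - 1) ≤ p J)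
    (f : ℤ → ℝ) (hf : ∀ J : ℤ, f J = ((N : ℝ) - (J : ℝ)) / N) :
    (∑ J ∈ Finset.Icc (0 : ℤ) (N : ℤ), (f J * μ J + (1 - f J) * μ (J - 1))) ≤ 1 ∧
    (∑ J ∈ Finset.Icc (0 : ℤ) (N : ℤ), (f J * μ J + (1 - f J) * μ (J - 1)))
      = ((N : ℝ) + 1) / N * ∑ J ∈ Finset.Icc (0 : ℤ) ((N : ℤ) - 1), μ J := by
  have hN' : (0 : ℝ) < N := by exact_mod_cast hN
  refine ⟨?_, ?_⟩
  · refine (Finset.sum_le_sum fun J hJ => ?_).trans_eq hpsum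
    obtain ⟨hJ0, hJN⟩ := Finset.mem_Icc.mp hJ
    have hJ0' : (0 : ℝ) ≤ J := by exact_mod_cast hJ0
    have hJN' : (J : ℝ) ≤ N := by exact_mod_cast hJN
    have hf0 : 0 ≤ f J := by
      rw [hf]
      exact div_nonneg (by linarith) hN'.le
    have hf1 : f J ≤ 1 := by
      rw [hf, div_le_one hN']
      linarith
    linarith [mul_le_mul_of_nonneg_left (h1 J hJ) hf0,
      mul_le_mul_of_nonneg_left (h2 J hJ) (sub_nonneg.mpr hf1)]
  · simp only [hf]
    rw [sum_Icc_weighted_shift (N : ℝ) hN'.ne' μ N, hμN, mul_zero, add_zero]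
end
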